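/- arXiv:2402.04969 — 3 statements merged into one kernel-verified Lean document; each statement's English description precedes it below -/
import Mathlib

section
/- For every real α with 0 < α ≤ 1 and every real x ≥ 0, the value E_α(−x) is strictly positive. -/
/-- The two-parameter Mittag-Leffler function `E_{α,β}(x) = ∑ x ^ k / Γ(α k + β)`
for real `x`. The classical Mittag-Leffler function is `E_α = E_{α,1}`. -/
noncomputable def mittagLeffler (α β : ℝ) (x : ℝ) : ℝ :=
  ∑' k : ℕ, x ^ k / Real.Gamma (α * k + β)

open MeasureTheory Set Filter Topology

/-- An exponential lower bound of every rate for the Gamma function on the positive axis. -/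
lemma Real.exp_mul_le_Gamma (c : ℝ) {s : ℝ} (hs : 0 < s) :
    Real.exp (c * s) * Real.exp (-Real.exp (c + 1)) ≤ Real.Gamma s := by
  have hM : (0 : ℝ) < Real.exp (c + 1) := Real.exp_pos _
  have hint := Real.GammaIntegral_convergent (s := s + 1) (by linarith)
  have key : Real.exp (c + 1) ^ s * Real.exp (-Real.exp (c + 1)) ≤ Real.Gamma (s + 1) := by
    rw [Real.Gamma_eq_integral (by linarith), ← integral_exp_neg_Ioi, ← integral_const_mul]
    calc ∫ t in Ioi (Real.exp (c + 1)), Real.exp (c + 1) ^ s * Real.exp (-t)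
        ≤ ∫ t in Ioi (Real.exp (c + 1)), Real.exp (-t) * t ^ (s + 1 - 1) := by
          refine setIntegral_mono_on ((integrableOn_exp_neg_Ioi _).const_mul _)
            (hint.mono_set (Ioi_subset_Ioi hM.le)) measurableSet_Ioi fun t ht => ?_
          rw [mul_comm, add_sub_cancel_right]
          gcongr
          exact le_of_lt ht
      _ ≤ ∫ t in Ioi 0, Real.exp (-t) * t ^ (s + 1 - 1) := by
          refine setIntegral_mono_set hint ?_ (Ioi_subset_Ioi hM.le).eventuallyLE
          filter_upwards [ae_restrict_mem measurableSet_Ioi] with t ht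
          have : (0 : ℝ) < t := ht
          simp only [Pi.zero_apply]
          positivity
  rw [Real.Gamma_add_one hs.ne', ← Real.exp_mul] at key
  have hse : s ≤ Real.exp s := by linarith [Real.add_one_le_exp s]
  have hG := Real.Gamma_pos_of_pos hs
  have h2 : Real.exp s * (Real.exp (c * s) * Real.exp (-Real.exp (c + 1))) ≤
      Real.exp s * Real.Gamma s := by
    calc _ = Real.exp ((c + 1) * s) * Real.exp (-Real.exp (c + 1)) := by
          rw [← mul_assoc, ← Real.exp_add]; ring_nf
      _ ≤ s * Real.Gamma s := key
      _ ≤ _ := by gcongr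
  exact le_of_mul_le_mul_left h2 (Real.exp_pos s)

lemma summable_pow_div_Gamma {α β : ℝ} (hα : 0 < α) (hβ : 0 < β) (x : ℝ) :
    Summable fun k : ℕ => x ^ k / Real.Gamma (α * k + β) := by
  set c : ℝ := Real.log (2 * (|x| + 1)) / α with hc
  set C : ℝ := Real.exp (c * β) * Real.exp (-Real.exp (c + 1)) with hC
  have hR : 0 < 2 * (|x| + 1) := by positivity
  refine Summable.of_norm_bounded (g := fun k : ℕ => (1 / 2 : ℝ) ^ k * C⁻¹)
    (summable_geometric_two.mul_right _) fun k => ?_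
  have hs : 0 < α * k + β := by positivity
  have hG := Real.exp_mul_le_Gamma c hs
  have hexp : Real.exp (c * (α * k + β)) = (2 * (|x| + 1)) ^ k * Real.exp (c * β) := by
    rw [mul_add, Real.exp_add]
    congr 1
    rw [show c * (α * k) = k * Real.log (2 * (|x| + 1)) by rw [hc]; field_simp,
      Real.exp_nat_mul, Real.exp_log hR]
  rw [hexp, mul_assoc, ← hC] at hG
  have hCpos : 0 < C := by positivity
  rw [norm_div, norm_pow, Real.norm_eq_abs, Real.norm_of_nonneg (Real.Gamma_pos_of_pos hs).le,
    div_le_iff₀ (Real.Gamma_pos_of_pos hs)]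
  calc |x| ^ k ≤ (|x| + 1) ^ k := by gcongr; linarith
    _ = (1 / 2) ^ k * C⁻¹ * ((2 * (|x| + 1)) ^ k * C) := by
      rw [mul_pow, div_pow, one_pow]; field_simp
    _ ≤ _ := by gcongr

lemma hasDerivAt_tsum_mul_pow {a : ℕ → ℝ} (ha : ∀ R : ℝ, Summable fun k => a k * R ^ k) (z : ℝ) :
    HasDerivAt (fun y => ∑' k, a k * y ^ k) (∑' k : ℕ, a k * (k * z ^ (k - 1))) z := by
  set R : ℝ := |z| + 1 with hR
  have hR1 : 1 ≤ R := by rw [hR]; linarith [abs_nonneg z]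
  have hR0 : 0 < R := by linarith
  have hz : z ∈ Metric.ball (0 : ℝ) R := by simp [hR]
  have hpre : IsPreconnected (Metric.ball (0 : ℝ) R) := (convex_ball 0 R).isPreconnected
  refine hasDerivAt_tsum_of_isPreconnected (g := fun n y => a n * y ^ n)
    (g' := fun n y => a n * (n * y ^ (n - 1))) (ha (2 * R)).norm Metric.isOpen_ball hpre
    (fun n y _ => (hasDerivAt_pow n y).const_mul _) (fun n y hy => ?_)
    (Metric.mem_ball_self hR0) (ha 0) hz
  rw [mem_ball_zero_iff] at hy
  rw [norm_mul, norm_mul, norm_mul, norm_pow, norm_pow, norm_mul, Real.norm_natCast, mul_pow,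
    Real.norm_ofNat, Real.norm_of_nonneg (by linarith : 0 ≤ R)]
  gcongr ‖a n‖ * (?_ * ?_)
  · exact_mod_cast Nat.lt_two_pow_self.le
  · calc ‖y‖ ^ (n - 1) ≤ R ^ (n - 1) := by gcongr
      _ ≤ R ^ n := pow_le_pow_right₀ hR1 (Nat.sub_le _ _)

lemma hasDerivAt_mittagLeffler {α β : ℝ} (hα : 0 < α) (hβ : 0 < β) (z : ℝ) :
    HasDerivAt (mittagLeffler α β)
      (∑' k : ℕ, (Real.Gamma (α * k + β))⁻¹ * (k * z ^ (k - 1))) z := by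
  have := hasDerivAt_tsum_mul_pow (a := fun k : ℕ => (Real.Gamma (α * k + β))⁻¹)
    (fun R => by simpa [div_eq_inv_mul] using summable_pow_div_Gamma hα hβ R) z
  rwa [show mittagLeffler α β = fun y => ∑' k : ℕ, (Real.Gamma (α * k + β))⁻¹ * y ^ k from
    funext fun y => tsum_congr fun k => div_eq_inv_mul _ _]

lemma hasDerivAt_mittagLeffler_one {α : ℝ} (hα : 0 < α) (z : ℝ) :
    HasDerivAt (mittagLeffler α 1) (mittagLeffler α α z / α) z := by
  convert hasDerivAt_mittagLeffler hα one_pos z using 1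
  rw [mittagLeffler, ← tsum_div_const]
  have h (k : ℕ) : (Real.Gamma (α * (k + 1 : ℕ) + 1))⁻¹ * ((k + 1 : ℕ) * z ^ (k + 1 - 1)) =
      z ^ k / Real.Gamma (α * k + α) / α := by
    have hk : 0 < α * k + α := by positivity
    have hG := Real.Gamma_pos_of_pos hk
    rw [show α * (k + 1 : ℕ) + 1 = α * k + α + 1 by push_cast; ring, Real.Gamma_add_one hk.ne',
      show α * k + α = α * (k + 1) by ring, add_tsub_cancel_right]
    rw [show α * k + α = α * (k + 1) by ring] at hG
    push_cast
    field_simp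
  rw [tsum_eq_zero_add' (f := fun k : ℕ => (Real.Gamma (α * k + 1))⁻¹ * (k * z ^ (k - 1)))]
  · simp_rw [h]
    simp
  · simp only [h]
    exact (summable_pow_div_Gamma hα hα z).div_const α

lemma continuous_mittagLeffler {α β : ℝ} (hα : 0 < α) (hβ : 0 < β) :
    Continuous (mittagLeffler α β) :=
  continuous_iff_continuousAt.2 fun z => (hasDerivAt_mittagLeffler hα hβ z).continuousAt

lemma mittagLeffler_one_zero (α : ℝ) : mittagLeffler α 1 0 = 1 := by
  rw [mittagLeffler, tsum_eq_single 0 (fun k hk => by simp [hk])]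
  simp

lemma mittagLeffler_one_one (z : ℝ) : mittagLeffler 1 1 z = Real.exp z := by
  rw [mittagLeffler, Real.exp_eq_exp_ℝ, NormedSpace.exp_eq_tsum_div]
  simp [Real.Gamma_nat_eq_factorial]

lemma integrableOn_rpow_mul_one_sub_rpow {u v : ℝ} (hu : 0 < u) (hv : 0 < v) :
    IntegrableOn (fun t : ℝ => t ^ (u - 1) * (1 - t) ^ (v - 1)) (Ioc 0 1) := by
  have h := Complex.betaIntegral_convergent (u := u) (v := v) (by simpa) (by simpa)
  rw [intervalIntegrable_iff_integrableOn_Ioc_of_le zero_le_one] at h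
  refine (Integrable.re h).congr ?_
  filter_upwards [ae_restrict_mem measurableSet_Ioc] with t ht
  have h1 : 0 ≤ 1 - t := by linarith [ht.2]
  have hc : (t : ℂ) ^ ((u : ℂ) - 1) * (1 - (t : ℂ)) ^ ((v : ℂ) - 1) =
      ((t ^ (u - 1) * (1 - t) ^ (v - 1) : ℝ) : ℂ) := by
    push_cast [Complex.ofReal_cpow ht.1.le, Complex.ofReal_cpow h1]
    rfl
  simp only [hc, RCLike.re_eq_complex_re, Complex.ofReal_re]

lemma integral_rpow_mul_one_sub_rpow {u v : ℝ} (hu : 0 < u) (hv : 0 < v) :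
    ∫ t in Ioc (0 : ℝ) 1, t ^ (u - 1) * (1 - t) ^ (v - 1) =
      Real.Gamma u * Real.Gamma v / Real.Gamma (u + v) := by
  have h := ProbabilityTheory.beta_eq_betaIntegralReal u v hu hv
  rw [ProbabilityTheory.beta] at h
  rw [h, Complex.betaIntegral, intervalIntegral.integral_of_le zero_le_one]
  rw [← Complex.ofReal_re (∫ t in Ioc (0 : ℝ) 1, t ^ (u - 1) * (1 - t) ^ (v - 1)),
    ← integral_complex_ofReal]
  congr 1
  refine setIntegral_congr_fun measurableSet_Ioc fun t ht => ?_
  have h1 : 0 ≤ 1 - t := by linarith [ht.2]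
  push_cast [Complex.ofReal_cpow ht.1.le, Complex.ofReal_cpow h1]
  rfl

/-- The fractional integral of order `1 - α` of `u ^ (α - 1) E_{α,α}(x u ^ α)`, evaluated at `1`. -/
lemma integral_mittagLeffler_self {α : ℝ} (hα : 0 < α) (hα1 : α < 1) (x : ℝ) :
    ∫ u in Ioc (0 : ℝ) 1, mittagLeffler α α (x * u ^ α) * (u ^ (α - 1) * (1 - u) ^ (-α)) =
      Real.Gamma (1 - α) * mittagLeffler α 1 x := by
  let F : ℕ → ℝ → ℝ := fun k u => x ^ k / Real.Gamma (α * k + α) *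
    (u ^ (α * k + α - 1) * (1 - u) ^ (1 - α - 1))
  have hs (k : ℕ) : 0 < α * k + α := by positivity
  have hα' : 0 < 1 - α := by linarith
  have hint (k : ℕ) := integrableOn_rpow_mul_one_sub_rpow (hs k) hα'
  have hval (c : ℝ) (k : ℕ) : ∫ u in Ioc (0 : ℝ) 1, c / Real.Gamma (α * k + α) *
      (u ^ (α * k + α - 1) * (1 - u) ^ (1 - α - 1)) =
      Real.Gamma (1 - α) * (c / Real.Gamma (α * k + 1)) := by
    have := Real.Gamma_pos_of_pos (hs k)
    rw [integral_const_mul, integral_rpow_mul_one_sub_rpow (hs k) hα',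
      show α * k + α + (1 - α) = α * k + 1 by ring]
    field_simp
  have hnorm (k : ℕ) : ∫ u in Ioc (0 : ℝ) 1, ‖F k u‖ =
      Real.Gamma (1 - α) * (|x| ^ k / Real.Gamma (α * k + 1)) := by
    rw [← hval]
    refine setIntegral_congr_fun measurableSet_Ioc fun u hu => ?_
    have h0 := hu.1
    have h1 : 0 ≤ 1 - u := by linarith [hu.2]
    have := Real.Gamma_pos_of_pos (hs k)
    simp only [F]
    rw [norm_mul, norm_div, norm_pow, Real.norm_eq_abs, Real.norm_of_nonneg this.le,
      Real.norm_of_nonneg (by positivity)]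
  have hsum := hasSum_integral_of_summable_integral_norm (μ := volume.restrict (Ioc (0 : ℝ) 1))
    (F := F) (fun k => (hint k).const_mul _)
    (by simpa only [hnorm] using (summable_pow_div_Gamma hα one_pos |x|).mul_left _)
  rw [mittagLeffler, ← tsum_mul_left]
  simp only [F, hval] at hsum
  rw [hsum.tsum_eq]
  refine setIntegral_congr_fun measurableSet_Ioc fun u hu => ?_
  simp only [mittagLeffler]
  rw [← tsum_mul_right]
  refine tsum_congr fun k => ?_
  rw [show α * k + α - 1 = α * k + (α - 1) by ring, Real.rpow_add hu.1, Real.rpow_mul hu.1.le,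
    Real.rpow_natCast, mul_pow, show 1 - α - 1 = -α by ring]
  ring

lemma exists_pos_eq_zero_of_nonpos {f : ℝ → ℝ} (hf : Continuous f) (h0 : 0 < f 0) {x : ℝ}
    (hx : 0 ≤ x) (hfx : f x ≤ 0) : ∃ y, 0 < y ∧ f y = 0 ∧ ∀ t ∈ Icc 0 y, 0 ≤ f t := by
  have hne : (Icc 0 x ∩ f ⁻¹' {0}).Nonempty := by
    obtain ⟨y, hy, hfy⟩ := intermediate_value_Icc' hx hf.continuousOn ⟨hfx, h0.le⟩
    exact ⟨y, hy, hfy⟩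
  obtain ⟨y, ⟨hy, hfy⟩, hmin⟩ :=
    (isCompact_Icc.inter_right (isClosed_singleton.preimage hf)).exists_isLeast hne
  have hfy' : f y = 0 := hfy
  refine ⟨y, lt_of_le_of_ne hy.1 (by rintro rfl; exact h0.ne' hfy'), hfy', fun t ht => ?_⟩
  by_contra! h
  obtain ⟨s, hs, hfs⟩ := intermediate_value_Icc' ht.1 hf.continuousOn ⟨h.le, h0.le⟩
  have hys : y ≤ s := hmin ⟨⟨hs.1, hs.2.trans (ht.2.trans hy.2)⟩, hfs⟩
  have : t = y := le_antisymm ht.2 (hys.trans hs.2)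
  exact h.ne (this ▸ hfy')

/-- Extremum principle for the Caputo derivative: if `g` is nonnegative on `[0, 1]` and vanishes
at `1`, its Caputo derivative at `1` is at most `-g 0 / Γ(1 - α)`. -/
lemma integral_deriv_mul_rpow_le {α : ℝ} (hα : 0 < α) (hα1 : α < 1) {g g' : ℝ → ℝ}
    (hg : Continuous g) (hd : ∀ u, 0 < u → HasDerivAt g (g' u) u) (h1 : g 1 = 0)
    (hpos : ∀ u ∈ Icc (0 : ℝ) 1, 0 ≤ g u)
    (hint : IntegrableOn (fun u => g' u * (1 - u) ^ (-α)) (Ioc 0 1)) :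
    ∫ u in Ioc (0 : ℝ) 1, g' u * (1 - u) ^ (-α) ≤ -g 0 := by
  have hcont : ContinuousOn (fun u => g u * (1 - u) ^ (-α)) (Icc 0 1) := by
    have hc : Continuous (dslope g 1) := by
      rw [← continuousOn_univ, continuousOn_dslope univ_mem]
      exact ⟨hg.continuousOn, (hd 1 one_pos).differentiableAt⟩
    have : Continuous fun u : ℝ => -dslope g 1 u * (1 - u) ^ (1 - α) :=
      hc.neg.mul ((continuous_const.sub continuous_id).rpow_const
        fun _ => Or.inr (by linarith))
    refine this.continuousOn.congr fun u hu => ?_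
    rcases hu.2.eq_or_lt with rfl | hlt
    · simp [h1, Real.zero_rpow (sub_pos.2 hα1).ne']
    · have hu' : 0 < 1 - u := by linarith
      beta_reduce
      rw [dslope_of_ne _ hlt.ne, slope_def_field, h1, sub_zero, sub_eq_add_neg 1 α,
        Real.rpow_add hu', Real.rpow_one]
      have : u - 1 ≠ 0 := by linarith
      field_simp
      ring
  have h := intervalIntegral.integral_le_sub_of_hasDeriv_right_of_le (zero_le_one' ℝ) hcont
    (g' := fun u => g' u * (1 - u) ^ (-α) + g u * (α * (1 - u) ^ (-α - 1)))
    (fun u hu => ?_) ((integrableOn_Icc_iff_integrableOn_Ioc).2 hint) (fun u hu => ?_)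
  · rw [intervalIntegral.integral_of_le zero_le_one] at h
    simpa [h1] using h
  · have hu' : 0 < 1 - u := by linarith [hu.2]
    refine HasDerivAt.hasDerivWithinAt ((hd u hu.1).mul ?_)
    have := ((hasDerivAt_id u).const_sub 1).rpow_const (p := -α) (Or.inl hu'.ne')
    simpa using this
  · have hu' : 0 < 1 - u := by linarith [hu.2]
    have := hpos u ⟨hu.1.le, hu.2.le⟩
    have : 0 ≤ g u * (α * (1 - u) ^ (-α - 1)) := by positivity
    linarith

/-- For every real `α` with `0 < α ≤ 1` and every real `x ≥ 0`,
the value `E_α(-x)` is strictly positive. -/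
theorem mittagLeffler_neg_pos (α : ℝ) (hα : 0 < α) (hα1 : α ≤ 1) (x : ℝ) (hx : 0 ≤ x) :
    0 < mittagLeffler α 1 (-x) := by
  rcases hα1.eq_or_lt with rfl | hα1
  · rw [mittagLeffler_one_one]
    exact Real.exp_pos _
  by_contra! hneg
  have hcont := continuous_mittagLeffler hα one_pos
  obtain ⟨y, hy, hzero, hpos⟩ := exists_pos_eq_zero_of_nonpos
    (f := fun t => mittagLeffler α 1 (-t)) (hcont.comp continuous_neg)
    (by simp [mittagLeffler_one_zero]) hx hneg
  have hrpow : Continuous fun u : ℝ => -y * u ^ α :=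
    continuous_const.mul (continuous_id.rpow_const fun _ => Or.inr hα.le)
  have hg' (u : ℝ) : mittagLeffler α α (-y * u ^ α) / α * (-y * (α * u ^ (α - 1))) *
      (1 - u) ^ (-α) =
      -y * (mittagLeffler α α (-y * u ^ α) * (u ^ (α - 1) * (1 - u) ^ (-α))) := by
    field_simp
  have hint : IntegrableOn (fun u : ℝ =>
      mittagLeffler α α (-y * u ^ α) * (u ^ (α - 1) * (1 - u) ^ (-α))) (Ioc 0 1) := by
    have hbeta := integrableOn_rpow_mul_one_sub_rpow hα (sub_pos.2 hα1)
    rw [show 1 - α - 1 = -α by ring, ← integrableOn_Icc_iff_integrableOn_Ioc] at hbeta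
    rw [← integrableOn_Icc_iff_integrableOn_Ioc]
    exact hbeta.continuousOn_mul ((continuous_mittagLeffler hα hα).comp hrpow).continuousOn
      isCompact_Icc
  have h := integral_deriv_mul_rpow_le hα hα1 (g := fun u => mittagLeffler α 1 (-y * u ^ α))
    (g' := fun u => mittagLeffler α α (-y * u ^ α) / α * (-y * (α * u ^ (α - 1))))
    (hcont.comp hrpow)
    (fun u hu => (hasDerivAt_mittagLeffler_one hα _).comp u
      ((Real.hasDerivAt_rpow_const (Or.inl hu.ne')).const_mul (-y)))
    (by simpa using hzero)
    (fun u hu => by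
      have h1 : u ^ α ≤ 1 := Real.rpow_le_one hu.1 hu.2 hα.le
      have h0 : 0 ≤ u ^ α := Real.rpow_nonneg hu.1 α
      simpa using hpos (y * u ^ α) ⟨by positivity, by nlinarith⟩)
    (by simpa only [hg', IntegrableOn] using hint.const_mul (-y))
  simp only [hg'] at h
  rw [integral_const_mul, integral_mittagLeffler_self hα hα1, hzero, Real.zero_rpow hα.ne',
    mul_zero, mul_zero, mittagLeffler_one_zero] at h
  linarith
end

section
/- For every real α with 0 < α ≤ 1, the function t ↦ E_α(−t^α) is strictly decreasing on [0, ∞). -/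
open Filter Topology Finset

namespace MittagLeffler

/-- The even truncations of `∑ b k * (-y) ^ k` lie below the odd truncations of
`∑ b k * (-x) ^ k` whenever `0 ≤ x ≤ y`. -/
def TruncationOrdered (b : ℕ → ℝ) : Prop :=
  ∀ x y : ℝ, 0 ≤ x → x ≤ y → ∀ N : ℕ,
    ∑ k ∈ range (2 * N), b k * (-y) ^ k ≤ ∑ k ∈ range (2 * N + 1), b k * (-x) ^ k

lemma hasDerivAt_expTruncation (n : ℕ) (x : ℝ) :
    HasDerivAt (fun x : ℝ => ∑ k ∈ range (n + 1), (-x) ^ k / (k.factorial : ℝ))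
      (-∑ k ∈ range n, (-x) ^ k / (k.factorial : ℝ)) x := by
  have h (k : ℕ) : HasDerivAt (fun x : ℝ => (-x) ^ (k + 1) / ((k + 1).factorial : ℝ))
      (-((-x) ^ k / (k.factorial : ℝ))) x := by
    have h1 := (((hasDerivAt_id x).neg).pow (k + 1)).div_const ((k + 1).factorial : ℝ)
    refine (h1.congr_deriv ?_)
    have : (k.factorial : ℝ) ≠ 0 := by positivity
    have : (k : ℝ) + 1 ≠ 0 := by positivity
    simp [Nat.factorial_succ]
    field_simp
  have h2 := (HasDerivAt.fun_sum (u := range n) fun k _ => h k).add_const (1 : ℝ)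
  simp only [sum_range_succ' _ n]
  simpa using h2

lemma exp_sub_truncation_nonneg (n : ℕ) : ∀ x : ℝ, 0 ≤ x →
    0 ≤ (-1) ^ n * (Real.exp (-x) - ∑ k ∈ range n, (-x) ^ k / (k.factorial : ℝ)) := by
  induction n with
  | zero => intro x _; simpa using (Real.exp_pos (-x)).le
  | succ n ih =>
    intro x hx
    have hd (y : ℝ) : HasDerivAt (fun x : ℝ => (-1) ^ (n + 1) *
        (Real.exp (-x) - ∑ k ∈ range (n + 1), (-x) ^ k / (k.factorial : ℝ)))
        ((-1) ^ n * (Real.exp (-y) - ∑ k ∈ range n, (-y) ^ k / (k.factorial : ℝ))) y := by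
      have h1 : HasDerivAt (fun x : ℝ => Real.exp (-x)) (-Real.exp (-y)) y := by
        simpa using (hasDerivAt_id y).neg.exp
      refine ((h1.sub (hasDerivAt_expTruncation n y)).const_mul ((-1) ^ (n + 1))).congr_deriv ?_
      ring
    have hm : MonotoneOn (fun x : ℝ => (-1) ^ (n + 1) *
        (Real.exp (-x) - ∑ k ∈ range (n + 1), (-x) ^ k / (k.factorial : ℝ))) (Set.Ici 0) := by
      refine monotoneOn_of_deriv_nonneg (convex_Ici 0)
        (fun y _ => (hd y).continuousAt.continuousWithinAt)
        (fun y _ => (hd y).differentiableAt.differentiableWithinAt) fun y hy => ?_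
      rw [(hd y).deriv]
      rw [interior_Ici] at hy
      exact ih y (le_of_lt hy)
    have h0 := hm Set.self_mem_Ici hx hx
    simpa [sum_range_succ'] using h0

lemma truncationOrdered_inv_factorial :
    TruncationOrdered fun k => 1 / (k.factorial : ℝ) := by
  intro x y hx hxy N
  have h1 := exp_sub_truncation_nonneg (2 * N) y (hx.trans hxy)
  have h2 := exp_sub_truncation_nonneg (2 * N + 1) x hx
  rw [pow_mul, neg_one_sq, one_pow, one_mul] at h1
  rw [pow_succ, pow_mul, neg_one_sq, one_pow, one_mul] at h2
  have h3 : Real.exp (-y) ≤ Real.exp (-x) := Real.exp_le_exp.2 (by linarith)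
  simp only [one_div_mul_eq_div]
  linarith

lemma TruncationOrdered.mul_pow {b : ℕ → ℝ} (hb : TruncationOrdered b) {c : ℝ} (hc : 0 ≤ c) :
    TruncationOrdered fun k => c ^ k * b k := by
  intro x y hx hxy N
  have := hb (c * x) (c * y) (by positivity) (by gcongr) N
  have e (z : ℝ) (k : ℕ) : c ^ k * b k * (-z) ^ k = b k * (-(c * z)) ^ k := by
    rw [← mul_neg, _root_.mul_pow]; ring
  simpa only [e] using this

lemma integral_truncation (b : ℕ → ℝ) (m n : ℕ) (x : ℝ) :
    ∫ u in (0 : ℝ)..1, u ^ m * ∑ k ∈ range n, b k * (-(u * x)) ^ k =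
      ∑ k ∈ range n, b k * (-x) ^ k / (k + m + 1) := by
  have e (u : ℝ) : u ^ m * ∑ k ∈ range n, b k * (-(u * x)) ^ k =
      ∑ k ∈ range n, b k * (-x) ^ k * u ^ (k + m) := by
    rw [mul_sum]
    refine sum_congr rfl fun k _ => ?_
    rw [← mul_neg, _root_.mul_pow]; ring
  simp only [e]
  rw [intervalIntegral.integral_finsetSum
    fun k _ => Continuous.intervalIntegrable (by fun_prop) _ _]
  refine sum_congr rfl fun k _ => ?_
  rw [intervalIntegral.integral_const_mul, integral_pow]
  simp [div_eq_mul_inv]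

lemma TruncationOrdered.mul_ratio {b : ℕ → ℝ} (hb : TruncationOrdered b) {α : ℝ}
    (hα : 0 ≤ α) (hα1 : α ≤ 1) (m : ℕ) :
    TruncationOrdered fun k => (α * k + 1 + m) / (k + 1 + m) * b k := by
  intro x y hx hxy N
  have hI : ∫ u in (0 : ℝ)..1, u ^ m * ∑ k ∈ range (2 * N), b k * (-(u * y)) ^ k ≤
      ∫ u in (0 : ℝ)..1, u ^ m * ∑ k ∈ range (2 * N + 1), b k * (-(u * x)) ^ k := by
    refine intervalIntegral.integral_mono_on zero_le_one
      (Continuous.intervalIntegrable (by fun_prop) _ _)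
      (Continuous.intervalIntegrable (by fun_prop) _ _) fun u hu => ?_
    have hu0 : 0 ≤ u := hu.1
    exact mul_le_mul_of_nonneg_left (hb _ _ (by positivity) (by gcongr) N) (by positivity)
  rw [integral_truncation, integral_truncation] at hI
  have e (z : ℝ) (n : ℕ) : ∑ k ∈ range n, (α * k + 1 + m) / (k + 1 + m) * b k * (-z) ^ k =
      α * ∑ k ∈ range n, b k * (-z) ^ k +
        (1 - α) * (m + 1) * ∑ k ∈ range n, b k * (-z) ^ k / (k + m + 1) := by
    rw [mul_sum, mul_sum, ← sum_add_distrib]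
    refine sum_congr rfl fun k _ => ?_
    have : (k : ℝ) + 1 + m ≠ 0 := by positivity
    rw [show (k : ℝ) + m + 1 = k + 1 + m by ring]
    field_simp
    ring
  simp only [e]
  have h1 : 0 ≤ 1 - α := by linarith
  exact add_le_add (mul_le_mul_of_nonneg_left (hb x y hx hxy N) hα)
    (mul_le_mul_of_nonneg_left hI (by positivity))

lemma TruncationOrdered.mul_prod_ratio {b : ℕ → ℝ} (hb : TruncationOrdered b) {α : ℝ}
    (hα : 0 ≤ α) (hα1 : α ≤ 1) (n : ℕ) :
    TruncationOrdered fun k =>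
      (∏ j ∈ range n, ((α * k + 1 + j) / (k + 1 + j) : ℝ)) * b k := by
  induction n with
  | zero => simpa using hb
  | succ n ih =>
    have := ih.mul_ratio hα hα1 n
    simp only [prod_range_succ]
    convert this using 2
    ring

lemma TruncationOrdered.of_tendsto {b : ℕ → ℕ → ℝ} {c : ℕ → ℝ}
    (hb : ∀ᶠ n in atTop, TruncationOrdered (b n))
    (h : ∀ k, Tendsto (fun n => b n k) atTop (𝓝 (c k))) : TruncationOrdered c := by
  intro x y hx hxy N
  refine le_of_tendsto_of_tendsto
    (tendsto_finsetSum (range (2 * N)) fun k _ => (h k).mul_const ((-y) ^ k))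
    (tendsto_finsetSum (range (2 * N + 1)) fun k _ => (h k).mul_const ((-x) ^ k)) ?_
  filter_upwards [hb] with n hn using hn x y hx hxy N

lemma gammaSeq_div_gammaSeq (α : ℝ) (hα : 0 ≤ α) (k n : ℕ) (hn : n ≠ 0) :
    Real.GammaSeq (k + 1) n / Real.GammaSeq (α * k + 1) n =
      ((n : ℝ) ^ (1 - α)) ^ k *
        ∏ j ∈ range (n + 1), ((α * k + 1 + j) / (k + 1 + j) : ℝ) := by
  have hn' : (0 : ℝ) < n := by positivity
  have h1 : (n : ℝ) ^ ((k : ℝ) + 1) =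
      ((n : ℝ) ^ (1 - α)) ^ k * (n : ℝ) ^ (α * k + 1) := by
    rw [← Real.rpow_mul_natCast hn'.le, ← Real.rpow_add hn']
    ring_nf
  have h2 : (n : ℝ) ^ (α * k + 1) ≠ 0 := by positivity
  have h3 : ∏ j ∈ range (n + 1), ((k : ℝ) + 1 + j) ≠ 0 :=
    prod_ne_zero_iff.2 fun j _ => by positivity
  have h4 : ∏ j ∈ range (n + 1), (α * (k : ℝ) + 1 + j) ≠ 0 :=
    prod_ne_zero_iff.2 fun j _ => by positivity
  have h5 : (n.factorial : ℝ) ≠ 0 := by positivity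
  rw [prod_div_distrib, Real.GammaSeq, Real.GammaSeq, h1]
  field_simp

lemma truncationOrdered_inv_gamma {α : ℝ} (hα : 0 ≤ α) (hα1 : α ≤ 1) :
    TruncationOrdered fun k => 1 / Real.Gamma (α * k + 1) := by
  refine TruncationOrdered.of_tendsto (b := fun n k =>
    Real.GammaSeq (k + 1) n / Real.GammaSeq (α * k + 1) n * (1 / (k.factorial : ℝ))) ?_ fun k => ?_
  · filter_upwards [eventually_ne_atTop 0] with n hn
    have := (truncationOrdered_inv_factorial.mul_prod_ratio hα hα1 (n + 1)).mul_pow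
      (c := (n : ℝ) ^ (1 - α)) (by positivity)
    simpa only [gammaSeq_div_gammaSeq α hα _ n hn, mul_assoc] using this
  · have hG : Real.Gamma (α * k + 1) ≠ 0 := (Real.Gamma_pos_of_pos (by positivity)).ne'
    have hk : (k.factorial : ℝ) ≠ 0 := by positivity
    have h := ((Real.GammaSeq_tendsto_Gamma (k + 1)).div
      (Real.GammaSeq_tendsto_Gamma (α * k + 1)) hG).mul_const (1 / (k.factorial : ℝ))
    have e : Real.Gamma (k + 1) / Real.Gamma (α * k + 1) * (1 / (k.factorial : ℝ)) =
        1 / Real.Gamma (α * k + 1) := by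
      rw [Real.Gamma_nat_eq_factorial]
      field_simp
    exact e ▸ h

lemma rpow_mul_gamma_le {s α : ℝ} (hs : 1 < s) (hα : 0 < α) :
    (s - 1) ^ α * Real.Gamma s ≤ Real.Gamma (s + α) := by
  have h0 : 0 < s - 1 := by linarith
  have hG : 0 < Real.Gamma (s - 1) := Real.Gamma_pos_of_pos h0
  have hGs : 0 < Real.Gamma s := Real.Gamma_pos_of_pos (by linarith)
  have hGα : 0 < Real.Gamma (s + α) := Real.Gamma_pos_of_pos (by linarith)
  have h := Real.convexOn_log_Gamma.slope_mono_adjacent (x := s - 1) (y := s) (z := s + α)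
    (Set.mem_Ioi.2 h0) (Set.mem_Ioi.2 (by linarith)) (by linarith) (by linarith)
  have hrec : Real.Gamma s = (s - 1) * Real.Gamma (s - 1) := by
    simpa using Real.Gamma_add_one h0.ne'
  have hlog : Real.log (Real.Gamma s) = Real.log (s - 1) + Real.log (Real.Gamma (s - 1)) := by
    rw [hrec, Real.log_mul h0.ne' hG.ne']
  simp only [Function.comp_apply, add_sub_cancel_left, sub_sub_cancel, div_one] at h
  rw [le_div_iff₀ hα] at h
  rw [← Real.log_le_log_iff (by positivity) hGα, Real.log_mul (by positivity) hGs.ne',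
    Real.log_rpow h0]
  nlinarith

lemma tendsto_gamma_ratio {α : ℝ} (hα : 0 < α) :
    Tendsto (fun k : ℕ => ‖1 / Real.Gamma (α * k.succ + 1)‖ / ‖1 / Real.Gamma (α * k + 1)‖)
      atTop (𝓝 0) := by
  have hlim : Tendsto (fun k : ℕ => ((α * k : ℝ) ^ α)⁻¹) atTop (𝓝 0) :=
    ((tendsto_rpow_atTop hα).comp
      (tendsto_natCast_atTop_atTop.const_mul_atTop hα)).inv_tendsto_atTop
  refine squeeze_zero' (Eventually.of_forall fun k => by positivity) ?_ hlim
  filter_upwards [eventually_gt_atTop 0] with k hk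
  have hk' : (0 : ℝ) < k := by exact_mod_cast hk
  have hp : 0 < α * k := by positivity
  have h1 : 0 < Real.Gamma (α * k + 1) := Real.Gamma_pos_of_pos (by positivity)
  have h2 : 0 < Real.Gamma (α * k.succ + 1) := Real.Gamma_pos_of_pos (by positivity)
  have h := rpow_mul_gamma_le (s := α * k + 1) (by linarith) hα
  rw [add_sub_cancel_right, show α * k + 1 + α = α * k.succ + 1 by push_cast; ring] at h
  rw [Real.norm_of_nonneg (by positivity), Real.norm_of_nonneg (by positivity),
    div_div_eq_mul_div, div_one, one_div_mul_eq_div, div_le_iff₀ h2, inv_mul_eq_div,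
    le_div_iff₀ (by positivity)]
  linarith

lemma hasFPowerSeriesOnBall {α : ℝ} (hα : 0 < α) :
    HasFPowerSeriesOnBall (mittagLeffler α 1)
      (FormalMultilinearSeries.ofScalars ℝ fun k : ℕ => 1 / Real.Gamma (α * k + 1)) 0 ⊤ := by
  have hr : (FormalMultilinearSeries.ofScalars ℝ
      fun k : ℕ => 1 / Real.Gamma (α * k + 1)).radius = ⊤ :=
    FormalMultilinearSeries.ofScalars_radius_eq_top_of_tendsto ℝ _
      (Eventually.of_forall fun k =>
        one_div_ne_zero (Real.Gamma_pos_of_pos (by positivity)).ne') (tendsto_gamma_ratio hα)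
  have h := FormalMultilinearSeries.hasFPowerSeriesOnBall _ (hr ▸ ENNReal.zero_lt_top)
  rw [hr] at h
  convert h using 1
  funext x
  rw [mittagLeffler, FormalMultilinearSeries.sum]
  simp only [FormalMultilinearSeries.ofScalars_apply_eq, smul_eq_mul, one_div_mul_eq_div]

lemma tendsto_truncation {α : ℝ} (hα : 0 < α) (x : ℝ) :
    Tendsto (fun n => ∑ k ∈ range n, 1 / Real.Gamma (α * k + 1) * x ^ k) atTop
      (𝓝 (mittagLeffler α 1 x)) := by
  have h := (hasFPowerSeriesOnBall hα).hasSum (y := x) (by simp)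
  simp only [FormalMultilinearSeries.ofScalars_apply_eq, smul_eq_mul, zero_add] at h
  exact h.tendsto_sum_nat

lemma antitoneOn_comp_neg {α : ℝ} (hα : 0 < α) (hα1 : α ≤ 1) :
    AntitoneOn (fun x => mittagLeffler α 1 (-x)) (Set.Ici 0) := by
  intro x hx y _ hxy
  have h2 : Tendsto (fun N : ℕ => 2 * N) atTop atTop :=
    tendsto_id.const_mul_atTop' two_pos
  exact le_of_tendsto_of_tendsto' ((tendsto_truncation hα (-y)).comp h2)
    ((tendsto_truncation hα (-x)).comp ((tendsto_add_atTop_nat 1).comp h2))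
    fun N => truncationOrdered_inv_gamma hα.le hα1 x y hx hxy N

lemma strictAntiOn_comp_neg {α : ℝ} (hα : 0 < α) (hα1 : α ≤ 1) :
    StrictAntiOn (fun x => mittagLeffler α 1 (-x)) (Set.Ici 0) := by
  intro x hx y hy hxy
  have hanti := antitoneOn_comp_neg hα hα1
  refine lt_of_le_of_ne (hanti hx hy hxy.le) fun heq => ?_
  have hps := hasFPowerSeriesOnBall hα
  have han : AnalyticOnNhd ℝ (mittagLeffler α 1) Set.univ := by
    simpa using hps.analyticOnNhd
  obtain ⟨z, hyz, hzx⟩ := exists_between (neg_lt_neg hxy)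
  have hconst : mittagLeffler α 1 =ᶠ[𝓝 z] fun _ => mittagLeffler α 1 (-x) := by
    filter_upwards [Ioo_mem_nhds hyz hzx] with w hw
    have hw0 : (0 : ℝ) ≤ -w := by linarith [hw.2, Set.mem_Ici.1 hx]
    have h1 := hanti hx hw0 (by linarith [hw.2])
    have h2 := hanti hw0 hy (by linarith [hw.1])
    simp only [neg_neg] at h1 h2 heq
    exact le_antisymm h1 (heq ▸ h2)
  have hfun := han.eq_of_eventuallyEq analyticOnNhd_const hconst
  have hd := hps.hasFPowerSeriesAt.deriv
  rw [hfun, deriv_const, FormalMultilinearSeries.ofScalars_apply_eq] at hd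
  have hG : 0 < Real.Gamma (α * (1 : ℕ) + 1) := Real.Gamma_pos_of_pos (by positivity)
  simp at hd hG
  exact hG.ne hd

end MittagLeffler

/-- For every real `α` with `0 < α ≤ 1`, the function `t ↦ E_α(-t^α)` is
strictly decreasing on `[0, ∞)`. -/
theorem mittagLeffler_strictAntiOn (α : ℝ) (hα : 0 < α) (hα1 : α ≤ 1) :
    StrictAntiOn (fun t : ℝ => mittagLeffler α 1 (-(t ^ α))) (Set.Ici 0) := by
  intro s hs t ht hst
  exact MittagLeffler.strictAntiOn_comp_neg hα hα1 (Set.mem_Ici.2 (Real.rpow_nonneg hs α))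
    (Set.mem_Ici.2 (Real.rpow_nonneg ht α)) (Real.rpow_lt_rpow hs hst hα)
end

section
/- For every real α with 0 < α < 1, the limit as x → +∞ of x^{2α} · E_{α,α}(−x^α) equals sin(απ) Γ(α + 1) / π; equivalently, x^{α−1} E_{α,α}(−x^α) is asymptotic to (sin(απ) Γ(α+1)/π) · x^{−α−1} as x → +∞. -/
open Complex Filter Topology MeasureTheory Set

/-- The closed half strip `u ≤ re w`, `|im w| ≤ π`. -/
def halfStrip (u : ℝ) : Set ℂ := {w | u ≤ w.re ∧ |w.im| ≤ Real.pi}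

/-- The integral of `F` along the Hankel contour in the logarithmic coordinate `w = log ζ`: from
`+∞ - iπ` to `u - iπ`, then up to `u + iπ`, then to `+∞ + iπ`. -/
noncomputable def hankelIntegral (u : ℝ) (F : ℂ → ℂ) : ℂ :=
  I * (∫ φ in (-Real.pi)..Real.pi, F (u + φ * I)) + (∫ v in Ioi u, F (v + Real.pi * I)) -
    ∫ v in Ioi u, F (v + (-Real.pi : ℝ) * I)

/-- Continuity on the half strip together with integrability on its two horizontal sides. -/
structure HankelIntegrable (u : ℝ) (F : ℂ → ℂ) : Prop where
  continuousOn : ContinuousOn F (halfStrip u)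
  integrableOn_upper : IntegrableOn (fun v : ℝ => F (v + Real.pi * I)) (Ioi u)
  integrableOn_lower : IntegrableOn (fun v : ℝ => F (v + (-Real.pi : ℝ) * I)) (Ioi u)

/-- The integrand `e ^ ζ ζ ^ (-z) dζ` of the Hankel integral of `1 / Γ(z)`, in the coordinate
`w = log ζ`. -/
noncomputable def hankelKernel (z : ℝ) (w : ℂ) : ℂ := exp (exp w + (1 - z) * w)

lemma mem_halfStrip_vertical {u φ : ℝ} (hφ : φ ∈ Icc (-Real.pi) Real.pi) :
    (u + φ * I : ℂ) ∈ halfStrip u := by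
  simpa [halfStrip, abs_le] using hφ

lemma mem_halfStrip_horizontal {u v s : ℝ} (hs : |s| = Real.pi) (hv : u ≤ v) :
    (v + s * I : ℂ) ∈ halfStrip u := by
  simpa [halfStrip, hs] using hv

lemma abs_neg_pi : |(-Real.pi : ℝ)| = Real.pi := by
  rw [abs_neg, abs_of_pos Real.pi_pos]

lemma ContinuousOn.comp_vertical {u : ℝ} {F : ℂ → ℂ} (hF : ContinuousOn F (halfStrip u)) :
    ContinuousOn (fun φ : ℝ => F (u + φ * I)) (Icc (-Real.pi) Real.pi) :=
  hF.comp (by fun_prop) fun _ hφ => mem_halfStrip_vertical hφ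

lemma ContinuousOn.comp_horizontal {u s : ℝ} {F : ℂ → ℂ} (hF : ContinuousOn F (halfStrip u))
    (hs : |s| = Real.pi) : ContinuousOn (fun v : ℝ => F (v + s * I)) (Ioi u) :=
  hF.comp (by fun_prop) fun _ hv => mem_halfStrip_horizontal hs (le_of_lt hv)

namespace HankelIntegrable

variable {u : ℝ} {F G : ℂ → ℂ}

lemma intervalIntegrable (hF : HankelIntegrable u F) :
    IntervalIntegrable (fun φ : ℝ => F (u + φ * I)) volume (-Real.pi) Real.pi :=
  ContinuousOn.intervalIntegrable_of_Icc (by linarith [Real.pi_pos]) hF.continuousOn.comp_vertical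

lemma add (hF : HankelIntegrable u F) (hG : HankelIntegrable u G) :
    HankelIntegrable u (fun w => F w + G w) :=
  ⟨hF.1.add hG.1, hF.2.add hG.2, hF.3.add hG.3⟩

lemma const_mul (hF : HankelIntegrable u F) (c : ℂ) : HankelIntegrable u (fun w => c * F w) :=
  ⟨continuousOn_const.mul hF.1, hF.2.const_mul c, hF.3.const_mul c⟩

lemma zero : HankelIntegrable u (fun _ => 0) :=
  ⟨continuousOn_const, integrableOn_zero, integrableOn_zero⟩

lemma sum {ι : Type*} {s : Finset ι} {F : ι → ℂ → ℂ} (hF : ∀ i, HankelIntegrable u (F i)) :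
    HankelIntegrable u (fun w => ∑ i ∈ s, F i w) := by
  classical
  induction s using Finset.induction_on with
  | empty => simpa using zero
  | insert a s ha ih => simpa [Finset.sum_insert ha] using (hF a).add ih

lemma mul_bounded (hF : HankelIntegrable u F) {m : ℂ → ℂ} {C : ℝ}
    (hm : ContinuousOn m (halfStrip u)) (hb : ∀ w ∈ halfStrip u, ‖m w‖ ≤ C) :
    HankelIntegrable u (fun w => F w * m w) := by
  have key {s : ℝ} (hs : |s| = Real.pi) (h : IntegrableOn (fun v : ℝ => F (v + s * I)) (Ioi u)) :
      IntegrableOn (fun v : ℝ => F (v + s * I) * m (v + s * I)) (Ioi u) := by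
    refine Integrable.mul_bdd (c := C) h
      ((hm.comp_horizontal hs).aestronglyMeasurable measurableSet_Ioi) ?_
    filter_upwards [ae_restrict_mem measurableSet_Ioi] with v hv
    exact hb _ (mem_halfStrip_horizontal hs (le_of_lt hv))
  exact ⟨hF.1.mul hm, key (abs_of_pos Real.pi_pos) hF.2, key abs_neg_pi hF.3⟩

end HankelIntegrable

lemma hankelIntegral_congr {u : ℝ} {F G : ℂ → ℂ} (h : EqOn F G (halfStrip u)) :
    hankelIntegral u F = hankelIntegral u G := by
  have key {s : ℝ} (hs : |s| = Real.pi) :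
      ∫ v in Ioi u, F (v + s * I) = ∫ v in Ioi u, G (v + s * I) :=
    setIntegral_congr_fun measurableSet_Ioi fun v hv =>
      h (mem_halfStrip_horizontal hs (le_of_lt hv))
  rw [hankelIntegral, hankelIntegral, key (abs_of_pos Real.pi_pos), key abs_neg_pi]
  congr 3
  refine intervalIntegral.integral_congr fun φ hφ => h (mem_halfStrip_vertical ?_)
  rwa [uIcc_of_le (by linarith [Real.pi_pos])] at hφ

lemma hankelIntegral_add {u : ℝ} {F G : ℂ → ℂ} (hF : HankelIntegrable u F)
    (hG : HankelIntegrable u G) :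
    hankelIntegral u (fun w => F w + G w) = hankelIntegral u F + hankelIntegral u G := by
  simp only [hankelIntegral]
  rw [intervalIntegral.integral_add hF.intervalIntegrable hG.intervalIntegrable,
    integral_add hF.2 hG.2, integral_add hF.3 hG.3]
  ring

lemma hankelIntegral_const_mul (u : ℝ) (F : ℂ → ℂ) (c : ℂ) :
    hankelIntegral u (fun w => c * F w) = c * hankelIntegral u F := by
  simp only [hankelIntegral, intervalIntegral.integral_const_mul, integral_const_mul]
  ring

lemma hankelIntegral_sum {ι : Type*} {u : ℝ} {s : Finset ι} {F : ι → ℂ → ℂ}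
    (hF : ∀ i, HankelIntegrable u (F i)) :
    hankelIntegral u (fun w => ∑ i ∈ s, F i w) = ∑ i ∈ s, hankelIntegral u (F i) := by
  classical
  induction s using Finset.induction_on with
  | empty => simp [hankelIntegral]
  | insert a s ha ih =>
    simp only [Finset.sum_insert ha]
    rw [hankelIntegral_add (hF a) (.sum hF), ih]

/-- Dominated convergence for multipliers of a fixed integrand. -/
lemma tendsto_hankelIntegral_mul {ι : Type*} {l : Filter ι} [l.IsCountablyGenerated] {u C : ℝ}
    {F : ℂ → ℂ} {m : ι → ℂ → ℂ} {m₀ : ℂ → ℂ} (hF : HankelIntegrable u F)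
    (hm : ∀ᶠ i in l, ContinuousOn (m i) (halfStrip u))
    (hb : ∀ᶠ i in l, ∀ w ∈ halfStrip u, ‖m i w‖ ≤ C)
    (hlim : ∀ w ∈ halfStrip u, Tendsto (fun i => m i w) l (𝓝 (m₀ w))) :
    Tendsto (fun i => hankelIntegral u (fun w => F w * m i w)) l
      (𝓝 (hankelIntegral u (fun w => F w * m₀ w))) := by
  have key {s : ℝ} (hs : |s| = Real.pi) (h : IntegrableOn (fun v : ℝ => F (v + s * I)) (Ioi u)) :
      Tendsto (fun i => ∫ v in Ioi u, F (v + s * I) * m i (v + s * I)) l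
        (𝓝 (∫ v in Ioi u, F (v + s * I) * m₀ (v + s * I))) := by
    refine tendsto_integral_filter_of_dominated_convergence
      (fun v => ‖F (v + s * I)‖ * C) ?_ ?_ (h.norm.mul_const C) ?_
    · filter_upwards [hm] with i hi
      exact ((hF.1.mul hi).comp_horizontal hs).aestronglyMeasurable measurableSet_Ioi
    · filter_upwards [hb] with i hi
      filter_upwards [ae_restrict_mem measurableSet_Ioi] with v hv
      rw [norm_mul]
      gcongr
      exact hi _ (mem_halfStrip_horizontal hs (le_of_lt hv))
    · filter_upwards [ae_restrict_mem measurableSet_Ioi] with v hv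
      exact (hlim _ (mem_halfStrip_horizontal hs (le_of_lt hv))).const_mul _
  have hpi : (-Real.pi) ≤ Real.pi := by linarith [Real.pi_pos]
  refine ((Tendsto.const_mul I ?_).add (key (abs_of_pos Real.pi_pos) hF.2)).sub
    (key abs_neg_pi hF.3)
  refine intervalIntegral.tendsto_integral_filter_of_dominated_convergence
    (fun φ => ‖F (u + φ * I)‖ * C) ?_ ?_ (hF.intervalIntegrable.norm.mul_const C) ?_
  · filter_upwards [hm] with i hi
    rw [uIoc_of_le hpi]
    exact ((hF.1.mul hi).comp_vertical.mono Ioc_subset_Icc_self).aestronglyMeasurable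
      measurableSet_Ioc
  · filter_upwards [hb] with i hi
    filter_upwards with φ hφ
    rw [uIoc_of_le hpi] at hφ
    rw [norm_mul]
    gcongr
    exact hi _ (mem_halfStrip_vertical (Ioc_subset_Icc_self hφ))
  · filter_upwards with φ hφ
    rw [uIoc_of_le hpi] at hφ
    exact (hlim _ (mem_halfStrip_vertical (Ioc_subset_Icc_self hφ))).const_mul _

/-- Cauchy's theorem: the contour can be moved horizontally. -/
lemma hankelIntegral_eq_of_differentiableOn {u u' : ℝ} {F : ℂ → ℂ} (h : u ≤ u')
    (hF : HankelIntegrable u F) (hd : DifferentiableOn ℂ F (halfStrip u)) :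
    hankelIntegral u F = hankelIntegral u' F := by
  have hpi : (-Real.pi) ≤ Real.pi := by linarith [Real.pi_pos]
  have hc := integral_boundary_rect_eq_zero_of_differentiableOn F
    (u + (-Real.pi : ℝ) * I) (u' + Real.pi * I) (hd.mono (by
      intro w hw
      rw [mem_reProdIm] at hw
      simp only [add_re, ofReal_re, mul_re, I_re, mul_zero, ofReal_im, I_im, mul_one, sub_self,
        add_zero, add_im, mul_im, zero_add, uIcc_of_le h, uIcc_of_le hpi] at hw
      exact ⟨hw.1.1, abs_le.2 hw.2⟩))
  simp only [add_re, ofReal_re, mul_re, I_re, mul_zero, ofReal_im, I_im, mul_one, sub_self,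
        add_zero, add_im, mul_im, zero_add, smul_eq_mul] at hc
  have h1 := intervalIntegral.integral_Ioi_sub_Ioi hF.2 h
  have h2 := intervalIntegral.integral_Ioi_sub_Ioi hF.3 h
  simp only [hankelIntegral]
  linear_combination h1 - h2 - hc

lemma continuous_hankelKernel (z : ℝ) : Continuous (hankelKernel z) := by
  unfold hankelKernel; fun_prop

lemma hankelKernel_horizontal (z v : ℝ) {s : ℝ} (hs : exp (s * I) = -1) :
    hankelKernel z (v + s * I) =
      (Real.exp (-Real.exp v + (1 - z) * v) : ℝ) * exp ((1 - z) * s * I) := by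
  have h : exp (v + s * I) = -exp v := by rw [Complex.exp_add, hs, mul_neg_one]
  rw [hankelKernel, h, ofReal_exp, ← Complex.exp_add]
  push_cast
  congr 1
  ring

lemma exp_neg_pi_mul_I : exp ((-Real.pi : ℝ) * I) = -1 := by
  rw [ofReal_neg, neg_mul, Complex.exp_neg, exp_pi_mul_I]; norm_num

lemma norm_hankelKernel_horizontal (z v : ℝ) {s : ℝ} (hs : exp (s * I) = -1) :
    ‖hankelKernel z (v + s * I)‖ = Real.exp (-Real.exp v + (1 - z) * v) := by
  have : ((1 - z) * s * I : ℂ) = ((1 - z) * s : ℝ) * I := by push_cast; ring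
  rw [hankelKernel_horizontal z v hs, norm_mul, this, norm_exp_ofReal_mul_I, mul_one, norm_real,
    Real.norm_of_nonneg (Real.exp_pos _).le]

lemma tendsto_exp_neg_exp_add_mul (c : ℝ) :
    Tendsto (fun v : ℝ => Real.exp (-Real.exp v + c * v)) atTop (𝓝 0) := by
  refine ((tendsto_rpow_mul_exp_neg_mul_atTop_nhds_zero c 1 one_pos).comp
    Real.tendsto_exp_atTop).congr fun v => ?_
  rw [Function.comp_apply, ← Real.exp_mul, ← Real.exp_add]
  congr 1
  ring

lemma integrableOn_exp_neg_exp_add_mul (c u : ℝ) :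
    IntegrableOn (fun v : ℝ => Real.exp (-Real.exp v + c * v)) (Ioi u) := by
  refine integrable_of_isBigO_exp_neg one_pos (by fun_prop) ?_
  refine Asymptotics.IsLittleO.isBigO ?_
  rw [Asymptotics.isLittleO_iff_tendsto fun v hv => absurd hv (Real.exp_pos _).ne']
  refine (tendsto_exp_neg_exp_add_mul (c + 1)).congr fun v => ?_
  rw [← Real.exp_sub]
  congr 1
  ring

lemma hankelIntegrable_hankelKernel (z u : ℝ) : HankelIntegrable u (hankelKernel z) := by
  have key {s : ℝ} (hs : exp (s * I) = -1) :
      IntegrableOn (fun v : ℝ => hankelKernel z (v + s * I)) (Ioi u) := by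
    refine (integrableOn_exp_neg_exp_add_mul (1 - z) u).mono'
      ((continuous_hankelKernel z).comp (by fun_prop)).aestronglyMeasurable ?_
    filter_upwards with v using (norm_hankelKernel_horizontal z v hs).le
  exact ⟨(continuous_hankelKernel z).continuousOn, key exp_pi_mul_I, key exp_neg_pi_mul_I⟩

lemma hankelIntegral_hankelKernel_eq (z u u' : ℝ) :
    hankelIntegral u (hankelKernel z) = hankelIntegral u' (hankelKernel z) := by
  have hd : Differentiable ℂ (hankelKernel z) := by unfold hankelKernel; fun_prop
  rcases le_total u u' with h | h
  · exact hankelIntegral_eq_of_differentiableOn h (hankelIntegrable_hankelKernel z u)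
      hd.differentiableOn
  · exact (hankelIntegral_eq_of_differentiableOn h (hankelIntegrable_hankelKernel z u')
      hd.differentiableOn).symm

/-- The recursion matching `Γ(z + 1) = z Γ(z)`. -/
lemma hankelIntegral_hankelKernel_add_one (z u : ℝ) :
    hankelIntegral u (hankelKernel z) = z * hankelIntegral u (hankelKernel (z + 1)) := by
  have hder (w : ℂ) : HasDerivAt (hankelKernel (z + 1))
      (hankelKernel z w + (-z : ℂ) * hankelKernel (z + 1) w) w := by
    have h := ((hasDerivAt_exp w).add ((hasDerivAt_id w).const_mul (1 - (z + 1 : ℝ) : ℂ))).cexp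
    refine h.congr_deriv ?_
    have : hankelKernel z w = exp w * hankelKernel (z + 1) w := by
      rw [hankelKernel, hankelKernel, ← Complex.exp_add]; push_cast; congr 1; ring
    rw [this, hankelKernel]
    simp only [Pi.add_apply, id]
    push_cast; ring
  have hI := (hankelIntegrable_hankelKernel z u).add
    ((hankelIntegrable_hankelKernel (z + 1) u).const_mul (-z : ℂ))
  have ray {s : ℝ} (hs : exp (s * I) = -1) (h : IntegrableOn (fun v : ℝ =>
      hankelKernel z (v + s * I) + (-z : ℂ) * hankelKernel (z + 1) (v + s * I)) (Ioi u)) :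
      ∫ v in Ioi u, (hankelKernel z (v + s * I) + (-z : ℂ) * hankelKernel (z + 1) (v + s * I)) =
        0 - hankelKernel (z + 1) (u + s * I) := by
    refine integral_Ioi_of_hasDerivAt_of_tendsto
      (f := fun v : ℝ => hankelKernel (z + 1) (v + s * I))
      ((continuous_hankelKernel _).comp (by fun_prop)).continuousWithinAt (fun v _ => ?_) h ?_
    · have h1 : HasDerivAt (fun v : ℝ => (v + s * I : ℂ)) 1 v := ofRealCLM.hasDerivAt.add_const _
      exact (HasDerivAt.comp (h₂ := hankelKernel (z + 1)) v (hder (v + s * I)) h1).congr_deriv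
        (mul_one _)
    · rw [tendsto_zero_iff_norm_tendsto_zero]
      simpa only [norm_hankelKernel_horizontal _ _ hs] using tendsto_exp_neg_exp_add_mul _
  have arc : ∫ φ in (-Real.pi)..Real.pi, (hankelKernel z (u + φ * I) +
      (-z : ℂ) * hankelKernel (z + 1) (u + φ * I)) * I =
      hankelKernel (z + 1) (u + Real.pi * I) - hankelKernel (z + 1) (u + (-Real.pi : ℝ) * I) := by
    refine intervalIntegral.integral_eq_sub_of_hasDerivAt
      (f := fun φ : ℝ => hankelKernel (z + 1) (u + φ * I)) (fun φ _ => ?_)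
      (hI.intervalIntegrable.mul_const I)
    have h1 : HasDerivAt (fun φ : ℝ => (u + φ * I : ℂ)) I φ := by
      simpa using (ofRealCLM.hasDerivAt.mul_const I).const_add (u : ℂ)
    exact HasDerivAt.comp (h₂ := hankelKernel (z + 1)) φ (hder (u + φ * I)) h1
  have h0 : hankelIntegral u
      (fun w => hankelKernel z w + (-z : ℂ) * hankelKernel (z + 1) w) = 0 := by
    rw [hankelIntegral, ray exp_pi_mul_I hI.2, ray exp_neg_pi_mul_I hI.3]
    rw [intervalIntegral.integral_mul_const] at arc
    linear_combination arc
  rw [hankelIntegral_add (hankelIntegrable_hankelKernel z u)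
    ((hankelIntegrable_hankelKernel (z + 1) u).const_mul (-z : ℂ)), hankelIntegral_const_mul] at h0
  linear_combination h0

lemma tendsto_integral_Ioi_exp_neg_exp_add_mul {c : ℝ} (hc : 0 < c) :
    Tendsto (fun u : ℝ => ∫ v in Ioi u, Real.exp (-Real.exp v + c * v)) atBot
      (𝓝 (Real.Gamma c)) := by
  have himg : Real.exp '' univ = Ioi 0 := by rw [image_univ, Real.range_exp]
  have hfun : (fun v : ℝ => |Real.exp v| • (Real.exp (-Real.exp v) * Real.exp v ^ (c - 1))) =
      fun v => Real.exp (-Real.exp v + c * v) := by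
    funext v
    rw [abs_of_pos (Real.exp_pos v), smul_eq_mul, ← Real.exp_mul, ← Real.exp_add, ← Real.exp_add]
    congr 1
    ring
  have hd (v : ℝ) (_ : v ∈ univ) : HasDerivWithinAt Real.exp (Real.exp v) univ v :=
    (Real.hasDerivAt_exp v).hasDerivWithinAt
  have hint : Integrable (fun v : ℝ => Real.exp (-Real.exp v + c * v)) := by
    have h := Real.GammaIntegral_convergent hc
    rw [← himg, integrableOn_image_iff_integrableOn_abs_deriv_smul MeasurableSet.univ hd
      Real.exp_injective.injOn, hfun, integrableOn_univ] at h
    exact h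
  rw [Real.Gamma_eq_integral hc, ← himg, integral_image_eq_integral_abs_deriv_smul
    MeasurableSet.univ hd Real.exp_injective.injOn, hfun, setIntegral_univ]
  exact (aecover_Ioi tendsto_id).integral_tendsto_of_countably_generated hint

lemma tendsto_integral_hankelKernel_vertical {z : ℝ} (hz : z ≤ 1) {c : ℂ}
    (hc : ∀ φ : ℝ, Tendsto (fun u : ℝ => exp ((1 - z) * (u + φ * I))) atBot (𝓝 c)) :
    Tendsto (fun u : ℝ => ∫ φ in (-Real.pi)..Real.pi, hankelKernel z (u + φ * I)) atBot
      (𝓝 (2 * Real.pi * c)) := by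
  have hval : (2 * Real.pi * c : ℂ) = ∫ φ in (-Real.pi)..Real.pi, c := by
    rw [intervalIntegral.integral_const, real_smul]; push_cast; ring
  have hnorm (u φ : ℝ) : ‖exp (u + φ * I : ℂ)‖ = Real.exp u := by simp [norm_exp]
  rw [hval]
  refine intervalIntegral.tendsto_integral_filter_of_dominated_convergence
    (fun _ => Real.exp 1) ?_ ?_ (by simp) ?_
  · filter_upwards with u
    exact ((continuous_hankelKernel z).comp (by fun_prop)).aestronglyMeasurable
  · filter_upwards [eventually_le_atBot 0] with u hu
    filter_upwards with φ _
    rw [hankelKernel, norm_exp, Real.exp_le_exp, add_re]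
    have h1 : (exp (u + φ * I : ℂ)).re ≤ 1 :=
      (re_le_norm _).trans ((hnorm u φ).le.trans (Real.exp_le_one_iff.2 hu))
    have h2 : ((1 - z) * (u + φ * I) : ℂ).re = (1 - z) * u := by simp
    rw [h2]
    nlinarith [mul_nonneg (sub_nonneg.2 hz) (neg_nonneg.2 hu)]
  · filter_upwards with φ _
    have h0 : Tendsto (fun u : ℝ => exp (u + φ * I : ℂ)) atBot (𝓝 0) := by
      rw [tendsto_zero_iff_norm_tendsto_zero]
      simpa only [hnorm] using Real.tendsto_exp_atBot
    have h1 := ((continuous_exp.tendsto 0).comp h0).mul (hc φ)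
    rw [Complex.exp_zero, one_mul] at h1
    refine h1.congr fun u => ?_
    rw [hankelKernel, Complex.exp_add, Function.comp_apply]

lemma sin_mul_Gamma_one_sub {z : ℝ} (hz : z < 1) :
    Real.sin (Real.pi * z) * Real.Gamma (1 - z) = Real.pi * (Real.Gamma z)⁻¹ := by
  have h := Real.Gamma_mul_Gamma_one_sub z
  have hpos : Real.Gamma (1 - z) ≠ 0 := (Real.Gamma_pos_of_pos (by linarith)).ne'
  by_cases hs : Real.sin (Real.pi * z) = 0
  · rw [hs, div_zero] at h
    have : Real.Gamma z = 0 := (mul_eq_zero.1 h).resolve_right hpos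
    simp [hs, this]
  · have hg : Real.Gamma z ≠ 0 := by
      intro hg
      rw [hg, zero_mul, eq_comm, div_eq_zero_iff] at h
      exact h.elim Real.pi_ne_zero hs
    rw [eq_div_iff hs] at h
    rw [← div_eq_mul_inv, eq_div_iff hg]
    linear_combination h

lemma hankelIntegral_hankelKernel_of_le_one {z : ℝ} (hz : z ≤ 1) (u : ℝ) :
    hankelIntegral u (hankelKernel z) = 2 * Real.pi * I * ((Real.Gamma z)⁻¹ : ℝ) := by
  have hrays (u : ℝ) : hankelIntegral u (hankelKernel z) =
      I * (∫ φ in (-Real.pi)..Real.pi, hankelKernel z (u + φ * I)) +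
        2 * I * Real.sin (Real.pi * z) *
          (∫ v in Ioi u, Real.exp (-Real.exp v + (1 - z) * v) : ℝ) := by
    have hsin : exp ((1 - z) * Real.pi * I) - exp ((1 - z) * (-Real.pi : ℝ) * I) =
        2 * I * Real.sin (Real.pi * z) := by
      have h : Real.sin (Real.pi * z) = Real.sin ((1 - z) * Real.pi) := by
        rw [← Real.sin_pi_sub]; congr 1; ring
      rw [h, ofReal_sin, Complex.sin]
      push_cast
      ring_nf
      simp only [I_sq]
      ring
    simp only [hankelIntegral, hankelKernel_horizontal z _ exp_pi_mul_I,
      hankelKernel_horizontal z _ exp_neg_pi_mul_I, integral_mul_const]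
    rw [← hsin, integral_complex_ofReal]
    ring
  suffices h : Tendsto (fun u => hankelIntegral u (hankelKernel z)) atBot
      (𝓝 (2 * Real.pi * I * ((Real.Gamma z)⁻¹ : ℝ))) by
    refine tendsto_nhds_unique (tendsto_const_nhds.congr fun u' => ?_) h
    exact hankelIntegral_hankelKernel_eq z u u'
  simp only [hrays]
  rcases hz.lt_or_eq with hz' | rfl
  · have harc := tendsto_integral_hankelKernel_vertical hz (c := 0) fun φ => by
      rw [tendsto_zero_iff_norm_tendsto_zero]
      have h2 (u : ℝ) : ((1 - z) * (u + φ * I) : ℂ).re = (1 - z) * u := by simp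
      simp only [norm_exp, h2]
      exact Real.tendsto_exp_atBot.comp (tendsto_id.const_mul_atBot (sub_pos.2 hz'))
    have hG := (continuous_ofReal.tendsto _).comp
      (tendsto_integral_Ioi_exp_neg_exp_add_mul (sub_pos.2 hz'))
    have h := (harc.const_mul I).add (hG.const_mul (2 * I * Real.sin (Real.pi * z)))
    have hval : (2 * Real.pi * I * ((Real.Gamma z)⁻¹ : ℝ) : ℂ) =
        I * (2 * Real.pi * 0) + 2 * I * Real.sin (Real.pi * z) * Real.Gamma (1 - z) := by
      have := congrArg ofReal (sin_mul_Gamma_one_sub hz')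
      rw [ofReal_mul, ofReal_mul] at this
      linear_combination (-2 * I) * this
    rw [hval]
    exact h
  · have harc := tendsto_integral_hankelKernel_vertical le_rfl (c := 1) fun φ => by simp
    simpa [mul_comm, mul_left_comm, mul_assoc] using harc.const_mul I

/-- Hankel's formula for `1 / Γ(z)`. -/
lemma hankelIntegral_hankelKernel (z u : ℝ) :
    hankelIntegral u (hankelKernel z) = 2 * Real.pi * I * ((Real.Gamma z)⁻¹ : ℝ) := by
  suffices h : ∀ n : ℕ, ∀ z : ℝ, z ≤ n + 1 →
      hankelIntegral u (hankelKernel z) = 2 * Real.pi * I * ((Real.Gamma z)⁻¹ : ℝ) by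
    obtain ⟨n, hn⟩ := exists_nat_ge z
    exact h n z (by linarith)
  intro n
  induction n with
  | zero => exact fun z hz => hankelIntegral_hankelKernel_of_le_one (by simpa using hz) u
  | succ n ih =>
    intro z hz
    rcases le_or_gt z 1 with h1 | h1
    · exact hankelIntegral_hankelKernel_of_le_one h1 u
    have hne : z - 1 ≠ 0 := by linarith
    have h := ih (z - 1) (by push_cast at hz; linarith)
    rw [hankelIntegral_hankelKernel_add_one, sub_add_cancel] at h
    have hG := Real.Gamma_add_one hne
    rw [sub_add_cancel] at hG
    have hne' : ((z - 1 : ℝ) : ℂ) ≠ 0 := ofReal_ne_zero.2 hne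
    refine mul_left_cancel₀ hne' ?_
    rw [h, hG, mul_inv, ofReal_mul, ofReal_inv (z - 1)]
    field_simp

lemma cos_mul_pi_div_two_pos {α : ℝ} (hα : 0 < α) (hα1 : α < 1) :
    0 < Real.cos (α * Real.pi / 2) :=
  Real.cos_pos_of_mem_Ioo ⟨by nlinarith [Real.pi_pos], by nlinarith [Real.pi_pos]⟩

lemma cos_mul_le_norm_exp_add {α y : ℝ} (hα : 0 < α) (hα1 : α < 1) (hy : 0 < y) {w : ℂ}
    (hw : |w.im| ≤ Real.pi) :
    Real.cos (α * Real.pi / 2) * y ≤ ‖exp (α * w) + y‖ := by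
  set t : ℝ := α * w.im / 2 with ht
  have htle : |t| ≤ α * Real.pi / 2 := by
    rw [ht, abs_div, abs_mul, abs_of_pos hα, abs_two]
    gcongr
  have hcos : Real.cos (α * Real.pi / 2) ≤ Real.cos t := by
    rw [← Real.cos_abs t]
    exact Real.cos_le_cos_of_nonneg_of_le_pi (abs_nonneg t)
      (by nlinarith [Real.pi_pos]) htle
  have hpos := cos_mul_pi_div_two_pos hα hα1
  have hre : (exp ((-t : ℝ) * I) * (exp (α * w) + y)).re =
      (Real.exp (α * w.re) + y) * Real.cos t := by
    rw [mul_add, ← Complex.exp_add, add_re, re_mul_ofReal, exp_re, exp_ofReal_mul_I_re]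
    have h1 : ((-t : ℝ) * I + α * w : ℂ).re = α * w.re := by simp
    have h2 : ((-t : ℝ) * I + α * w : ℂ).im = t := by simp [ht]; ring
    rw [h1, h2, Real.cos_neg]
    ring
  calc Real.cos (α * Real.pi / 2) * y ≤ (Real.exp (α * w.re) + y) * Real.cos t := by
        nlinarith [mul_pos (Real.exp_pos (α * w.re)) (hpos.trans_le hcos)]
    _ ≤ ‖exp ((-t : ℝ) * I) * (exp (α * w) + y)‖ := hre ▸ re_le_norm _
    _ = ‖exp (α * w) + y‖ := by rw [norm_mul, norm_exp_ofReal_mul_I, one_mul]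

lemma exp_add_ne_zero {α y : ℝ} (hα : 0 < α) (hα1 : α < 1) (hy : 0 < y) {w : ℂ}
    (hw : |w.im| ≤ Real.pi) : exp (α * w) + y ≠ 0 :=
  norm_pos_iff.1 <| (mul_pos (cos_mul_pi_div_two_pos hα hα1) hy).trans_le
    (cos_mul_le_norm_exp_add hα hα1 hy hw)

lemma norm_mul_inv_exp_add_le {α y : ℝ} (hα : 0 < α) (hα1 : α < 1) (hy : 0 < y) {w : ℂ}
    (hw : |w.im| ≤ Real.pi) :
    ‖(y : ℂ) * (exp (α * w) + y)⁻¹‖ ≤ (Real.cos (α * Real.pi / 2))⁻¹ := by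
  have hc := cos_mul_pi_div_two_pos hα hα1
  have h := cos_mul_le_norm_exp_add hα hα1 hy hw
  have hp : 0 < ‖exp (α * w) + y‖ := norm_pos_iff.2 (exp_add_ne_zero hα hα1 hy hw)
  rw [norm_mul, norm_inv, norm_real, Real.norm_of_nonneg hy.le, ← div_eq_mul_inv, div_le_iff₀ hp,
    inv_mul_eq_div, le_div_iff₀ hc]
  linarith

lemma differentiableOn_inv_exp_add {α y : ℝ} (hα : 0 < α) (hα1 : α < 1) (hy : 0 < y) (u : ℝ) :
    DifferentiableOn ℂ (fun w : ℂ => (exp (α * w) + y)⁻¹) (halfStrip u) := by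
  refine DifferentiableOn.inv (by fun_prop) fun w hw => exp_add_ne_zero hα hα1 hy hw.2

lemma hankelIntegrable_mul_inv_exp_add {α y : ℝ} (hα : 0 < α) (hα1 : α < 1) (hy : 0 < y)
    (z u : ℝ) : HankelIntegrable u (fun w => hankelKernel z w * (y * (exp (α * w) + y)⁻¹)) :=
  (hankelIntegrable_hankelKernel z u).mul_bounded
    (continuousOn_const.mul (differentiableOn_inv_exp_add hα hα1 hy u).continuousOn)
    fun _ hw => norm_mul_inv_exp_add_le hα hα1 hy hw.2

/-- Termwise integration, far enough to the right for the geometric series to converge. -/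
lemma hasSum_hankelIntegral {α y u : ℝ} (hα : 0 < α) (hy : 0 < y)
    (hu : y * Real.exp (-(α * u)) < 1) :
    HasSum (fun k : ℕ => 2 * Real.pi * I * (((-y) ^ k / Real.Gamma (α * k + α) : ℝ) : ℂ))
      (hankelIntegral u (fun w => hankelKernel 0 w * (exp (α * w) + y)⁻¹)) := by
  set r := y * Real.exp (-(α * u)) with hr
  have hr0 : 0 ≤ r := by positivity
  have hnorm {w : ℂ} (hw : w ∈ halfStrip u) : ‖(-y : ℂ) * exp (-(α * w))‖ ≤ r := by
    have h1 : (-(α * w) : ℂ).re = -(α * w.re) := by simp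
    rw [norm_mul, norm_neg, norm_real, Real.norm_of_nonneg hy.le, norm_exp, h1, hr]
    gcongr
    exact hw.1
  have hlim := tendsto_hankelIntegral_mul (l := (atTop : Filter (Finset ℕ))) (C := (1 - r)⁻¹)
    (m := fun s w => ∑ k ∈ s, ((-y : ℂ) * exp (-(α * w))) ^ k)
    (m₀ := fun w => (1 - (-y : ℂ) * exp (-(α * w)))⁻¹) (hankelIntegrable_hankelKernel α u)
    (.of_forall fun s => by fun_prop)
    (.of_forall fun s w hw => by
      refine (norm_sum_le _ _).trans ?_
      rw [← tsum_geometric_of_lt_one hr0 hu]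
      refine (Finset.sum_le_sum fun k _ => ?_).trans
        ((summable_geometric_of_lt_one hr0 hu).sum_le_tsum s fun k _ => by positivity)
      rw [norm_pow]
      exact pow_le_pow_left₀ (norm_nonneg _) (hnorm hw) k)
    (fun w hw => hasSum_geometric_of_norm_lt_one ((hnorm hw).trans_lt hu))
  have hfun : (fun w => hankelKernel α w * (1 - (-y : ℂ) * exp (-(α * w)))⁻¹) =
      fun w => hankelKernel 0 w * (exp (α * w) + y)⁻¹ := by
    funext w
    have hk : hankelKernel α w = hankelKernel 0 w * exp (-(α * w)) := by
      rw [hankelKernel, hankelKernel, ← Complex.exp_add]; push_cast; congr 1; ring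
    have he : exp (α * w) + y = exp (α * w) * (1 - (-y : ℂ) * exp (-(α * w))) := by
      have : exp (α * w) * exp (-(α * w)) = 1 := by rw [← Complex.exp_add]; simp
      linear_combination (-y : ℂ) * this
    rw [hk, he, mul_inv, ← Complex.exp_neg, mul_assoc]
  rw [hfun] at hlim
  refine hlim.congr fun s => ?_
  have hterm : (fun w => hankelKernel α w * ∑ k ∈ s, ((-y : ℂ) * exp (-(α * w))) ^ k) =
      fun w => ∑ k ∈ s, (-y : ℂ) ^ k * hankelKernel (α * k + α) w := by
    funext w
    rw [Finset.mul_sum]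
    refine Finset.sum_congr rfl fun k _ => ?_
    rw [mul_pow, ← Complex.exp_nat_mul, mul_left_comm, hankelKernel, ← Complex.exp_add,
      hankelKernel]
    push_cast
    congr 2
    ring
  rw [hterm, hankelIntegral_sum fun k => (hankelIntegrable_hankelKernel _ u).const_mul _]
  refine Finset.sum_congr rfl fun k _ => ?_
  rw [hankelIntegral_const_mul, hankelIntegral_hankelKernel]
  push_cast
  ring

lemma mittagLeffler_neg_eq_hankelIntegral {α y : ℝ} (hα : 0 < α) (hα1 : α < 1) (hy : 0 < y) :
    2 * Real.pi * I * (mittagLeffler α α (-y) : ℂ) =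
      hankelIntegral 0 (fun w => hankelKernel 0 w * (exp (α * w) + y)⁻¹) := by
  have hlim : Tendsto (fun u : ℝ => y * Real.exp (-(α * u))) atTop (𝓝 (y * 0)) :=
    (Real.tendsto_exp_neg_atTop_nhds_zero.comp (tendsto_id.const_mul_atTop hα)).const_mul y
  rw [mul_zero] at hlim
  obtain ⟨u, hu, hu0⟩ := ((hlim.eventually_lt_const one_pos).and (eventually_ge_atTop 0)).exists
  have hint : HankelIntegrable 0 (fun w => hankelKernel 0 w * (exp (α * w) + y)⁻¹) := by
    have h := (hankelIntegrable_mul_inv_exp_add hα hα1 hy 0 0).const_mul (y : ℂ)⁻¹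
    have hy' : (y : ℂ) ≠ 0 := ofReal_ne_zero.2 hy.ne'
    convert h using 2 with w
    field_simp
  have hd : DifferentiableOn ℂ (fun w => hankelKernel 0 w * (exp (α * w) + y)⁻¹)
      (halfStrip 0) := by
    refine DifferentiableOn.mul ?_ (differentiableOn_inv_exp_add hα hα1 hy 0)
    unfold hankelKernel
    fun_prop
  rw [hankelIntegral_eq_of_differentiableOn hu0 hint hd,
    ← (hasSum_hankelIntegral hα hy hu).tsum_eq, tsum_mul_left, mittagLeffler, ofReal_tsum]

lemma tendsto_sq_mul_mittagLeffler_neg {α : ℝ} (hα : 0 < α) (hα1 : α < 1) :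
    Tendsto (fun y : ℝ => y ^ 2 * mittagLeffler α α (-y)) atTop
      (𝓝 (-(Real.Gamma (-α))⁻¹)) := by
  have hlim := tendsto_hankelIntegral_mul (l := (atTop : Filter ℝ))
    (m := fun (y : ℝ) w => (y : ℂ) * (exp (α * w) + y)⁻¹) (m₀ := fun _ => 1)
    (hankelIntegrable_hankelKernel (-α) 0)
    (by
      filter_upwards [eventually_gt_atTop 0] with y hy
      exact continuousOn_const.mul (differentiableOn_inv_exp_add hα hα1 hy 0).continuousOn)
    (by
      filter_upwards [eventually_gt_atTop 0] with y hy w hw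
      exact norm_mul_inv_exp_add_le hα hα1 hy hw.2)
    (fun w hw => by
      have h1 : Tendsto (fun y : ℝ => exp (α * w) * ((y⁻¹ : ℝ) : ℂ) + 1) atTop
          (𝓝 (exp (α * w) * ((0 : ℝ) : ℂ) + 1)) :=
        (((continuous_ofReal.tendsto 0).comp tendsto_inv_atTop_zero).const_mul _).add_const _
      rw [ofReal_zero, mul_zero, zero_add] at h1
      have h2 := h1.inv₀ one_ne_zero
      rw [inv_one] at h2
      refine h2.congr' ?_
      filter_upwards [eventually_gt_atTop 0] with y hy
      have hy' : (y : ℂ) ≠ 0 := ofReal_ne_zero.2 hy.ne'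
      have he : exp (α * w) + y = y * (exp (α * w) * ((y⁻¹ : ℝ) : ℂ) + 1) := by
        push_cast; field_simp
      rw [he, mul_inv, mul_inv_cancel_left₀ hy'])
  simp only [mul_one] at hlim
  rw [hankelIntegral_hankelKernel] at hlim
  have hpi : (2 * Real.pi * I : ℂ) ≠ 0 := two_pi_I_ne_zero
  have h3 : Tendsto (fun y : ℝ => ((y ^ 2 * mittagLeffler α α (-y) : ℝ) : ℂ)) atTop
      (𝓝 ((-(Real.Gamma (-α))⁻¹ : ℝ) : ℂ)) := by
    have h4 := hlim.const_mul (-(2 * Real.pi * I : ℂ)⁻¹)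
    have hval : -(2 * Real.pi * I : ℂ)⁻¹ * (2 * Real.pi * I * ((Real.Gamma (-α))⁻¹ : ℝ)) =
        ((-(Real.Gamma (-α))⁻¹ : ℝ) : ℂ) := by
      rw [neg_mul, inv_mul_cancel_left₀ hpi, ofReal_neg]
    rw [hval] at h4
    refine h4.congr' ?_
    filter_upwards [eventually_gt_atTop 0] with y hy
    have hml := mittagLeffler_neg_eq_hankelIntegral hα hα1 hy
    have hsplit : EqOn (fun w => (y : ℂ) ^ 2 * (hankelKernel 0 w * (exp (α * w) + y)⁻¹))
        (fun w => (y : ℂ) * hankelKernel 0 w +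
          (-1) * (hankelKernel (-α) w * (y * (exp (α * w) + y)⁻¹))) (halfStrip 0) := by
      intro w hw
      have hk : hankelKernel (-α) w = hankelKernel 0 w * exp (α * w) := by
        rw [hankelKernel, hankelKernel, ← Complex.exp_add]; push_cast; congr 1; ring
      have hne := exp_add_ne_zero hα hα1 hy hw.2
      simp only [hk]
      field_simp
      ring
    have h5 := hankelIntegral_congr hsplit
    rw [hankelIntegral_const_mul, hankelIntegral_add
      ((hankelIntegrable_hankelKernel 0 0).const_mul _)
      ((hankelIntegrable_mul_inv_exp_add hα hα1 hy (-α) 0).const_mul _),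
      hankelIntegral_const_mul, hankelIntegral_const_mul, ← hml, hankelIntegral_hankelKernel,
      Real.Gamma_zero, inv_zero, ofReal_zero, mul_zero, mul_zero, zero_add] at h5
    have h6 : hankelIntegral 0 (fun w => hankelKernel (-α) w * (y * (exp (α * w) + y)⁻¹)) =
        2 * Real.pi * I * (-(y ^ 2 * mittagLeffler α α (-y))) := by
      linear_combination h5
    rw [h6, neg_mul, inv_mul_cancel_left₀ hpi, neg_neg]
    push_cast
    rfl
  exact (continuous_re.tendsto _).comp h3

/-- For every real `α` with `0 < α < 1`,
`x^(2α) · E_{α,α}(-x^α) → sin(απ) Γ(α+1) / π` as `x → +∞`; equivalently,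
`x^(α-1) E_{α,α}(-x^α) ~ (sin(απ) Γ(α+1)/π) · x^(-α-1)` as `x → +∞`. -/
theorem mittagLeffler_two_param_asymptotic_atTop (α : ℝ) (hα : 0 < α) (hα1 : α < 1) :
    Filter.Tendsto (fun x : ℝ => x ^ (2 * α) * mittagLeffler α α (-(x ^ α)))
      Filter.atTop
      (nhds (Real.sin (α * Real.pi) * Real.Gamma (α + 1) / Real.pi)) ∧
    Filter.Tendsto
      (fun x : ℝ => (x ^ (α - 1) * mittagLeffler α α (-(x ^ α))) /
        ((Real.sin (α * Real.pi) * Real.Gamma (α + 1) / Real.pi) * x ^ (-α - 1)))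
      Filter.atTop (nhds 1) := by
  have hconst : -(Real.Gamma (-α))⁻¹ = Real.sin (α * Real.pi) * Real.Gamma (α + 1) / Real.pi := by
    have h := sin_mul_Gamma_one_sub (z := -α) (by linarith)
    rw [mul_neg, Real.sin_neg, sub_neg_eq_add, add_comm 1 α, mul_comm Real.pi α] at h
    rw [eq_div_iff Real.pi_ne_zero]
    linear_combination h
  have hsin : 0 < Real.sin (α * Real.pi) :=
    Real.sin_pos_of_pos_of_lt_pi (by positivity) (by nlinarith [Real.pi_pos])
  have hΓ : 0 < Real.Gamma (α + 1) := Real.Gamma_pos_of_pos (by linarith)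
  set c := Real.sin (α * Real.pi) * Real.Gamma (α + 1) / Real.pi with hc
  have hc0 : c ≠ 0 := by positivity
  have hmain : Tendsto (fun x : ℝ => x ^ (2 * α) * mittagLeffler α α (-(x ^ α))) atTop (𝓝 c) := by
    rw [← hconst]
    refine ((tendsto_sq_mul_mittagLeffler_neg hα hα1).comp (tendsto_rpow_atTop hα)).congr' ?_
    filter_upwards [eventually_gt_atTop 0] with x hx
    rw [Function.comp_apply, ← Real.rpow_natCast, ← Real.rpow_mul hx.le, mul_comm 2 α]
    norm_num
  refine ⟨hmain, ?_⟩
  have h := hmain.div_const c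
  rw [div_self hc0] at h
  refine h.congr' ?_
  filter_upwards [eventually_gt_atTop 0] with x hx
  have hx' : x ^ (α - 1) = x ^ (2 * α) * x ^ (-α - 1) := by
    rw [← Real.rpow_add hx]; congr 1; ring
  have hne : x ^ (-α - 1) ≠ 0 := (Real.rpow_pos_of_pos hx _).ne'
  rw [hx']
  field_simp
end
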